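/- arXiv:1702.00140 — 2 statements merged into one kernel-verified Lean document; each statement's English description precedes it below -/
import Mathlib

section
/- Suppose {q_n} is a sequence of positive reals such that the limit β = lim_{n→∞} n(1−q_n) exists in ℝ, and {a_n} is a sequence with a_n ∈ {1,…,n} and lim_{n→∞} a_n/n = a for some a ∈ [0,1]. Then the law of π(a_n)/n, where π is distributed according to the (n,q_n)-Mallows measure μ_{n,q_n}, converges in distribution as n → ∞ to the probability measure v on [0,1] with density f(y) = u(a,y,β) with respect to Lebesgue measure. -/
open Filter Finset MeasureTheory

/-- Number of inversions of a permutation of `Fin n`. -/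
def inversions (n : ℕ) (π : Equiv.Perm (Fin n)) : ℕ :=
  (Finset.univ.filter (fun p : Fin n × Fin n => p.1 < p.2 ∧ π p.2 < π p.1)).card

/-- The `(n,q)`-Mallows probability mass function on `S_n`. -/
noncomputable def mallowsPMF (n : ℕ) (q : ℝ) (π : Equiv.Perm (Fin n)) : ℝ :=
  q ^ inversions n π / ∑ σ : Equiv.Perm (Fin n), q ^ inversions n σ

open Classical in
/-- The `(n,q)`-Mallows probability of an event `P` of permutations. -/
noncomputable def mallowsProb (n : ℕ) (q : ℝ) (P : Equiv.Perm (Fin n) → Prop) : ℝ :=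
  ∑ π : Equiv.Perm (Fin n), if P π then mallowsPMF n q π else 0

/-- Expectation with respect to the `(n,q)`-Mallows measure. -/
noncomputable def mallowsExp (n : ℕ) (q : ℝ) (f : Equiv.Perm (Fin n) → ℝ) : ℝ :=
  ∑ π : Equiv.Perm (Fin n), mallowsPMF n q π * f π

/-- Action of a permutation of `Fin n` on one-based indices `{1,…,n}`. -/
def permAct (n : ℕ) (π : Equiv.Perm (Fin n)) (i : ℕ) : ℕ :=
  if h : 1 ≤ i ∧ i ≤ n then ((π ⟨i - 1, by omega⟩ : Fin n) : ℕ) + 1 else i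

/-- The limiting density `u(x,y,β)` from Starr's theorem. -/
noncomputable def mallowsU (x y β : ℝ) : ℝ :=
  if β = 0 then 1
  else (β / 2) * Real.sinh (β / 2) /
    (Real.exp (β / 4) * Real.cosh (β * (x - y) / 2)
      - Real.exp (-β / 4) * Real.cosh (β * (x + y - 1) / 2)) ^ 2


section Combinatorics

/-- The `q`-analogue `1 + q + ⋯ + q ^ (j - 1)` of the natural number `j`. -/
noncomputable def qInt (q : ℝ) (j : ℕ) : ℝ := ∑ i ∈ range j, q ^ i

/-- The `q`-rising factorial `[j][j + 1]⋯[j + k - 1]`. -/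
noncomputable def qRising (q : ℝ) (k j : ℕ) : ℝ := ∏ i ∈ range k, qInt q (j + i)

lemma qInt_add (q : ℝ) (i j : ℕ) : qInt q (i + j) = qInt q i + q ^ i * qInt q j := by
  simp [qInt, sum_range_add, pow_add, mul_sum]

lemma qInt_pos {q : ℝ} (hq : 0 < q) {j : ℕ} (hj : 0 < j) : 0 < qInt q j :=
  sum_pos (fun _ _ => pow_pos hq _) ⟨0, by simpa using hj⟩

lemma qRising_pos {q : ℝ} (hq : 0 < q) (k : ℕ) {j : ℕ} (hj : 0 < j) : 0 < qRising q k j :=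
  prod_pos fun _ _ => qInt_pos hq (by omega)

lemma qRising_succ (q : ℝ) (k j : ℕ) :
    qRising q (k + 1) j = qRising q k j * qInt q (j + k) := prod_range_succ _ _

lemma qRising_succ' (q : ℝ) (k j : ℕ) :
    qRising q (k + 1) j = qInt q j * qRising q k (j + 1) := by
  rw [qRising, prod_range_succ', mul_comm, qRising]
  simp only [Nat.add_zero, add_assoc, add_comm 1]

/-- The permutation of `Fin (n + 1)` with last value `p` whose other values are in the same
relative order as those of `σ`. -/
def insertLast {n : ℕ} (p : Fin (n + 1)) (σ : Equiv.Perm (Fin n)) : Equiv.Perm (Fin (n + 1)) :=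
  finSuccEquivLast.trans ((Equiv.optionCongr σ).trans (finSuccEquiv' p).symm)

@[simp] lemma insertLast_last {n : ℕ} (p : Fin (n + 1)) (σ : Equiv.Perm (Fin n)) :
    insertLast p σ (Fin.last n) = p := by
  simp [insertLast]

@[simp] lemma insertLast_castSucc {n : ℕ} (p : Fin (n + 1)) (σ : Equiv.Perm (Fin n)) (i : Fin n) :
    insertLast p σ i.castSucc = p.succAbove (σ i) := by
  simp [insertLast]

lemma insertLast_bijective (n : ℕ) :
    Function.Bijective
      (fun x : Fin (n + 1) × Equiv.Perm (Fin n) => insertLast x.1 x.2) := by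
  rw [Fintype.bijective_iff_injective_and_card]
  refine ⟨?_, by simp [Fintype.card_perm, Nat.factorial_succ]⟩
  rintro ⟨p, σ⟩ ⟨p', σ'⟩ h
  have h1 : p = p' := by simpa using congrArg (fun τ => τ (Fin.last n)) h
  subst h1
  refine Prod.ext rfl (Equiv.ext fun i => ?_)
  simpa using congrArg (fun τ => τ i.castSucc) h

lemma card_lt_succAbove {n : ℕ} (p : Fin (n + 1)) :
    (univ.filter fun j : Fin n => p < p.succAbove j).card = n - p := by
  have : (univ.filter fun j : Fin n => p < p.succAbove j)
      = univ.filter fun j : Fin n => (p : ℕ) ≤ j := by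
    ext j
    simp [Fin.lt_succAbove_iff_le_castSucc, Fin.le_def]
  rw [this, card_filter, Fin.sum_univ_eq_sum_range (fun j => if (p : ℕ) ≤ j then 1 else 0),
    ← card_filter, ← Nat.card_Ico]
  congr 1
  ext j
  simp [and_comm]

lemma inversions_insertLast {n : ℕ} (p : Fin (n + 1)) (σ : Equiv.Perm (Fin n)) :
    inversions (n + 1) (insertLast p σ) = inversions n σ + (n - p) := by
  have hσ : (univ.filter fun i : Fin n => p < p.succAbove (σ i)).card = n - p := by
    rw [← card_lt_succAbove p]
    exact card_bij (fun i _ => σ i) (by simp) (fun _ _ _ _ h => σ.injective h)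
      (fun j hj => ⟨σ.symm j, by simpa using hj, by simp⟩)
  rw [← hσ]
  simp only [inversions, card_filter, ← univ_product_univ, sum_product, Fin.sum_univ_castSucc]
  simp [Fin.castSucc_lt_last, sum_add_distrib, Fin.succAbove_lt_succAbove_iff,
    Fin.not_lt.2 (Fin.le_last _)]

/-- The unnormalised Mallows expectation of `G (π a)`. -/
noncomputable def mallowsSum (n : ℕ) (q : ℝ) (G : ℕ → ℝ) (a : ℕ) : ℝ :=
  ∑ π : Equiv.Perm (Fin n), q ^ inversions n π * G (permAct n π a)

lemma mallowsExp_eq_div (n : ℕ) (q : ℝ) (G : ℕ → ℝ) (a : ℕ) :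
    mallowsExp n q (fun π => G (permAct n π a))
      = mallowsSum n q G a / ∑ σ : Equiv.Perm (Fin n), q ^ inversions n σ := by
  simp only [mallowsExp, mallowsSum, mallowsPMF, sum_div, div_mul_eq_mul_div]

lemma sum_perm_succ {n : ℕ} (F : Equiv.Perm (Fin (n + 1)) → ℝ) :
    ∑ π, F π = ∑ σ : Equiv.Perm (Fin n), ∑ p, F (insertLast p σ) := by
  rw [← (insertLast_bijective n).sum_comp F, ← univ_product_univ, sum_product_right]

lemma sum_pow_sub (q : ℝ) (n : ℕ) : ∑ p : Fin (n + 1), q ^ (n - (p : ℕ)) = qInt q (n + 1) := by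
  rw [Fin.sum_univ_eq_sum_range fun p => q ^ (n - p), qInt, ← sum_range_reflect (q ^ ·)]
  rfl

lemma sum_pow_inversions_succ (n : ℕ) (q : ℝ) :
    ∑ σ : Equiv.Perm (Fin (n + 1)), q ^ inversions (n + 1) σ
      = qInt q (n + 1) * ∑ σ : Equiv.Perm (Fin n), q ^ inversions n σ := by
  simp only [sum_perm_succ, inversions_insertLast, pow_add, ← mul_sum, sum_pow_sub]
  rw [← sum_mul, mul_comm]

lemma permAct_insertLast_of_le {n a : ℕ} (h1 : 1 ≤ a) (h2 : a ≤ n) (p : Fin (n + 1))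
    (σ : Equiv.Perm (Fin n)) :
    permAct (n + 1) (insertLast p σ) a = (p.succAbove (σ ⟨a - 1, by omega⟩) : ℕ) + 1 := by
  have : (⟨a - 1, by omega⟩ : Fin (n + 1)) = Fin.castSucc ⟨a - 1, by omega⟩ := rfl
  rw [permAct, dif_pos ⟨h1, by omega⟩, this, insertLast_castSucc]

lemma sum_qRising_succAbove (q : ℝ) (k n : ℕ) (j : Fin n) :
    ∑ p : Fin (n + 1), q ^ (n - (p : ℕ)) * qRising q k ((p.succAbove j : ℕ) + 1)
      = qInt q (n + 1 + k) * qRising q k ((j : ℕ) + 1) := by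
  obtain ⟨d, hd⟩ : ∃ d, n = j + 1 + d := ⟨n - (j + 1), by omega⟩
  have h : ∀ p : Fin (n + 1), q ^ (n - (p : ℕ)) * qRising q k ((p.succAbove j : ℕ) + 1)
      = (fun p : ℕ => q ^ (n - p) *
        (if p < j + 1 then qRising q k (j + 2) else qRising q k (j + 1))) p := by
    intro p
    simp only [Fin.succAbove, Fin.lt_def, Fin.val_castSucc]
    split_ifs <;> first | rfl | omega
  rw [sum_congr rfl fun p _ => h p, Fin.sum_univ_eq_sum_range (fun p : ℕ => q ^ (n - p) *
        (if p < j + 1 then qRising q k (j + 2) else qRising q k (j + 1)))]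
  have e : n + 1 = (j + 1) + (d + 1) := by omega
  rw [e, sum_range_add]
  have s1 : ∑ p ∈ range ((j : ℕ) + 1), q ^ (n - p) *
        (if p < j + 1 then qRising q k (j + 2) else qRising q k (j + 1))
      = q ^ (d + 1) * qInt q (j + 1) * qRising q k (j + 2) := by
    rw [qInt, ← sum_range_reflect (q ^ ·), mul_sum, sum_mul]
    refine sum_congr rfl fun p hp => ?_
    rw [mem_range] at hp
    rw [if_pos hp, ← pow_add]
    congr 2
    omega
  have s2 : ∑ p ∈ range (d + 1), q ^ (n - (j + 1 + p)) *
        (if j + 1 + p < j + 1 then qRising q k (j + 2) else qRising q k (j + 1))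
      = qInt q (d + 1) * qRising q k (j + 1) := by
    rw [qInt, ← sum_range_reflect (q ^ ·), sum_mul]
    refine sum_congr rfl fun p hp => ?_
    rw [if_neg (by omega)]
    congr 2
    omega
  rw [s1, s2, mul_assoc, ← qRising_succ', qRising_succ,
    show (j : ℕ) + 1 + (d + 1) + k = (d + 1) + (j + 1 + k) by omega, qInt_add q (d + 1)]
  ring

lemma mallowsSum_qRising_succ (q : ℝ) (k : ℕ) {n a : ℕ} (h1 : 1 ≤ a) (h2 : a ≤ n) :
    mallowsSum (n + 1) q (qRising q k) a
      = qInt q (n + 1 + k) * mallowsSum n q (qRising q k) a := by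
  rw [mallowsSum, sum_perm_succ, mallowsSum, mul_sum]
  refine sum_congr rfl fun σ _ => ?_
  simp only [inversions_insertLast, permAct_insertLast_of_le h1 h2, pow_add, mul_assoc]
  rw [← mul_sum, sum_qRising_succAbove, permAct, dif_pos ⟨h1, h2⟩]
  ring

lemma mallowsSum_self (q : ℝ) (G : ℕ → ℝ) (n : ℕ) :
    mallowsSum (n + 1) q G (n + 1)
      = (∑ j ∈ range (n + 1), q ^ (n - j) * G (j + 1)) *
        ∑ σ : Equiv.Perm (Fin n), q ^ inversions n σ := by
  have h : ∀ p σ, permAct (n + 1) (insertLast p σ) (n + 1) = (p : ℕ) + 1 := by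
    intro p σ
    have : (⟨n + 1 - 1, by omega⟩ : Fin (n + 1)) = Fin.last n := rfl
    rw [permAct, dif_pos ⟨by omega, le_rfl⟩, this, insertLast_last]
  rw [mallowsSum, sum_perm_succ, ← Fin.sum_univ_eq_sum_range (fun j => q ^ (n - j) * G (j + 1)),
    mul_sum]
  refine sum_congr rfl fun σ _ => ?_
  simp only [inversions_insertLast, h, pow_add, sum_mul]
  exact sum_congr rfl fun p _ => by ring

lemma sum_pow_inversions_pos (n : ℕ) {q : ℝ} (hq : 0 < q) :
    0 < ∑ σ : Equiv.Perm (Fin n), q ^ inversions n σ :=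
  sum_pos (fun _ _ => pow_pos hq _) ⟨1, mem_univ _⟩

/-- Exact formula for the `q`-rising factorial moments of `π a` under the Mallows measure. -/
theorem mallowsExp_qRising {q : ℝ} (hq : 0 < q) (k : ℕ) {n a : ℕ} (h1 : 1 ≤ a) (h2 : a ≤ n) :
    mallowsExp n q (fun π => qRising q k (permAct n π a))
      = qRising q k (n + 1) *
        ((∑ j ∈ range a, q ^ (a - (j + 1)) * qRising q k (j + 1)) / qRising q (k + 1) a) := by
  induction n, h2 using Nat.le_induction with
  | base =>
    obtain ⟨m, rfl⟩ : ∃ m, a = m + 1 := ⟨a - 1, by omega⟩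
    have h := (sum_pow_inversions_pos m hq).ne'
    have h3 := (qRising_pos hq k (j := m + 1 + 1) (by omega)).ne'
    have h4 := (qInt_pos hq (j := m + 1) (by omega)).ne'
    rw [mallowsExp_eq_div, mallowsSum_self, sum_pow_inversions_succ, qRising_succ']
    simp only [Nat.add_sub_add_right]
    field_simp
  | succ n hn ih =>
    have h := (sum_pow_inversions_pos n hq).ne'
    have h4 := (qInt_pos hq (j := n + 1) (by omega)).ne'
    have h5 : qRising q k (n + 1 + 1)
        = qInt q (n + 1 + k) / qInt q (n + 1) * qRising q k (n + 1) := by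
      rw [div_mul_eq_mul_div, eq_div_iff h4, mul_comm, ← qRising_succ', qRising_succ, mul_comm]
    rw [h5, mul_assoc, ← ih, mallowsExp_eq_div, mallowsExp_eq_div,
      mallowsSum_qRising_succ q k h1 hn, sum_pow_inversions_succ]
    field_simp

lemma sum_pow_mul_qRising (q : ℝ) (k a : ℕ) :
    (∑ j ∈ range a, q ^ j * qRising q k (j + 1)) * qInt q (k + 1) = qRising q (k + 1) a := by
  induction a with
  | zero => simp [qRising_succ', qInt]
  | succ a ih =>
    rw [sum_range_succ, add_mul, ih, qRising_succ', qRising_succ,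
      show a + 1 + k = a + (k + 1) by omega, qInt_add q a (k + 1)]
    ring

lemma mallowsPMF_nonneg (n : ℕ) {q : ℝ} (hq : 0 < q) (π : Equiv.Perm (Fin n)) :
    0 ≤ mallowsPMF n q π :=
  div_nonneg (pow_pos hq _).le (sum_pow_inversions_pos n hq).le

lemma sum_mallowsPMF (n : ℕ) {q : ℝ} (hq : 0 < q) : ∑ π, mallowsPMF n q π = 1 := by
  simp only [mallowsPMF, ← sum_div]
  exact div_self (sum_pow_inversions_pos n hq).ne'

lemma abs_mallowsExp_sub_le {n : ℕ} {q : ℝ} (hq : 0 < q) {F G : Equiv.Perm (Fin n) → ℝ} {ε : ℝ}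
    (h : ∀ π, |F π - G π| ≤ ε) : |mallowsExp n q F - mallowsExp n q G| ≤ ε := by
  rw [mallowsExp, mallowsExp, ← sum_sub_distrib]
  calc |∑ π, (mallowsPMF n q π * F π - mallowsPMF n q π * G π)|
      ≤ ∑ π, |mallowsPMF n q π * F π - mallowsPMF n q π * G π| := abs_sum_le_sum_abs _ _
    _ ≤ ∑ π, mallowsPMF n q π * ε := by
        refine sum_le_sum fun π _ => ?_
        rw [← mul_sub, abs_mul, abs_of_nonneg (mallowsPMF_nonneg n hq π)]
        exact mul_le_mul_of_nonneg_left (h π) (mallowsPMF_nonneg n hq π)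
    _ = ε := by rw [← sum_mul, sum_mallowsPMF n hq, one_mul]

lemma permAct_mem_Icc {n a : ℕ} (h1 : 1 ≤ a) (h2 : a ≤ n) (π : Equiv.Perm (Fin n)) :
    1 ≤ permAct n π a ∧ permAct n π a ≤ n := by
  rw [permAct, dif_pos ⟨h1, h2⟩]
  omega

end Combinatorics

section Analysis

open Topology

/-- The integral of `r ↦ exp (-(b * r))` over `[0, y]`. -/
noncomputable def expInt (b y : ℝ) : ℝ := ∫ r in (0 : ℝ)..y, Real.exp (-(b * r))

lemma expInt_zero_right (b : ℝ) : expInt b 0 = 0 := intervalIntegral.integral_same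

lemma expInt_zero_left (y : ℝ) : expInt 0 y = y := by simp [expInt]

lemma continuous_expInt : Continuous fun p : ℝ × ℝ => expInt p.1 p.2 :=
  intervalIntegral.continuous_parametric_intervalIntegral_of_continuous
    (f := fun (p : ℝ × ℝ) r => Real.exp (-(p.1 * r))) (by fun_prop) continuous_snd

lemma hasDerivAt_expInt (b y : ℝ) : HasDerivAt (expInt b) (Real.exp (-(b * y))) y :=
  (by fun_prop : Continuous fun r : ℝ => Real.exp (-(b * r))).integral_hasStrictDerivAt 0 y
    |>.hasDerivAt

lemma continuous_expInt_right (b : ℝ) : Continuous (expInt b) :=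
  continuous_iff_continuousAt.2 fun y => (hasDerivAt_expInt b y).continuousAt

lemma strictMono_expInt (b : ℝ) : StrictMono (expInt b) :=
  strictMono_of_hasDerivAt_pos (hasDerivAt_expInt b) fun _ => Real.exp_pos _

lemma expInt_pos (b : ℝ) {y : ℝ} (hy : 0 < y) : 0 < expInt b y := by
  simpa [expInt_zero_right] using strictMono_expInt b hy

lemma mul_expInt (b y : ℝ) : b * expInt b y = 1 - Real.exp (-(b * y)) := by
  have h := intervalIntegral.integral_eq_sub_of_hasDerivAt (a := 0) (b := y)
    (f := fun r => 1 - Real.exp (-(b * r))) (f' := fun r => b * Real.exp (-(b * r)))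
    (fun r _ => by
      simpa [mul_comm] using (((hasDerivAt_id' r).const_mul b).neg.exp).const_sub 1)
    ((by fun_prop : Continuous fun r : ℝ => b * Real.exp (-(b * r))).intervalIntegrable _ _)
  rw [intervalIntegral.integral_const_mul] at h
  simpa [expInt] using h

lemma expInt_add (b x y : ℝ) : expInt b (x + y) = expInt b x + Real.exp (-(b * x)) * expInt b y := by
  rcases eq_or_ne b 0 with rfl | hb
  · simp [expInt_zero_left]
  · apply mul_left_cancel₀ hb
    rw [mul_add, mul_left_comm b, mul_expInt, mul_expInt, mul_expInt, mul_add, neg_add, Real.exp_add]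
    ring

lemma expInt_mul (b c y : ℝ) : expInt b (c * y) = c * expInt (b * c) y := by
  have := intervalIntegral.mul_integral_comp_mul_left (a := 0) (b := y)
    (f := fun r => Real.exp (-(b * r))) c
  rw [mul_zero] at this
  rw [expInt, ← this, expInt]
  simp only [mul_assoc]

lemma qInt_exp_mul_expInt (b h : ℝ) (j : ℕ) :
    qInt (Real.exp (-(b * h))) j * expInt b h = expInt b (j * h) := by
  induction j with
  | zero => simp [qInt, expInt_zero_right]
  | succ j ih =>
    rw [qInt_add, add_mul, ih, Nat.cast_succ, add_mul, one_mul, expInt_add, ← Real.exp_nat_mul]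
    simp [qInt]
    left
    ring

lemma qInt_exp_mul (b : ℝ) {h : ℝ} (hh : h ≠ 0) (j : ℕ) :
    qInt (Real.exp (-(b * h))) j * h = (expInt (b * h) 1)⁻¹ * expInt b (j * h) := by
  have h1 := expInt_mul b h 1
  rw [mul_one] at h1
  rw [← qInt_exp_mul_expInt, h1]
  field_simp [(expInt_pos (b * h) one_pos).ne']

/-- The continuous counterpart of `qRising`, with parameters `p = (b, h, c)` where `h` is the mesh
and `c` a normalising constant. -/
noncomputable def expRising (k : ℕ) (p : ℝ × ℝ × ℝ) (y : ℝ) : ℝ :=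
  ∏ i ∈ range k, p.2.2 * expInt p.1 (y + i * p.2.1)

lemma continuous_expRising (k : ℕ) :
    Continuous fun x : (ℝ × ℝ × ℝ) × ℝ => expRising k x.1 x.2 := by
  refine continuous_finsetProd _ fun i _ => ?_
  exact (by fun_prop : Continuous fun x : (ℝ × ℝ × ℝ) × ℝ => x.1.2.2).mul
    (continuous_expInt.comp (by fun_prop :
      Continuous fun x : (ℝ × ℝ × ℝ) × ℝ => (x.1.1, x.2 + i * x.1.2.1)))

lemma expRising_limit (k : ℕ) (β y : ℝ) : expRising k (β, 0, 1) y = expInt β y ^ k := by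
  simp [expRising]

lemma qRising_exp_mul (b : ℝ) {h : ℝ} (hh : h ≠ 0) (k j : ℕ) :
    qRising (Real.exp (-(b * h))) k j * h ^ k
      = expRising k (b, h, (expInt (b * h) 1)⁻¹) (j * h) := by
  rw [qRising, expRising, ← card_range k, ← prod_const, card_range, ← prod_mul_distrib]
  refine prod_congr rfl fun i _ => ?_
  rw [qInt_exp_mul b hh]
  push_cast
  rw [add_mul]

/-- Jointly continuous families converge uniformly on `[0, 1]` in the second variable. -/
lemma eventually_uniform_Icc {P ι : Type*} [TopologicalSpace P] {F : P → ℝ → ℝ}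
    (hF : Continuous fun x : P × ℝ => F x.1 x.2) {l : Filter ι} {p : ι → P} {p₀ : P}
    (hp : Tendsto p l (𝓝 p₀)) {ε : ℝ} (hε : 0 < ε) :
    ∀ᶠ n in l, ∀ y ∈ Set.Icc (0 : ℝ) 1, |F (p n) y - F p₀ y| < ε := by
  obtain ⟨v, hv, h⟩ := isCompact_Icc.mem_uniformity_of_prod (f := F) (s := Set.univ)
    (k := Set.Icc (0 : ℝ) 1) (q := p₀) hF.continuousOn (Set.mem_univ _)
    (Metric.dist_mem_uniformity hε)
  rw [nhdsWithin_univ] at hv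
  filter_upwards [hp hv] with n hn y hy
  exact h _ hn y hy

/-- Riemann sums with a moving integrand and a moving endpoint. -/
lemma tendsto_riemann_sum {P : Type*} [TopologicalSpace P] {F : P → ℝ → ℝ}
    (hF : Continuous fun x : P × ℝ => F x.1 x.2) {p : ℕ → P} {p₀ : P}
    (hp : Tendsto p atTop (𝓝 p₀)) {a : ℕ → ℕ} (ha : ∀ n, 1 ≤ n → a n ≤ n) {α : ℝ}
    (haα : Tendsto (fun n => (a n : ℝ) / n) atTop (𝓝 α)) :
    Tendsto (fun n : ℕ => ∑ j ∈ range (a n), F (p n) ((j + 1 : ℕ) * (n : ℝ)⁻¹) * (n : ℝ)⁻¹) atTop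
      (𝓝 (∫ y in (0 : ℝ)..α, F p₀ y)) := by
  have hF0 : Continuous (F p₀) := hF.comp (Continuous.prodMk_right p₀)
  have hint : ∀ x y : ℝ, IntervalIntegrable (F p₀) volume x y := fun x y =>
    hF0.intervalIntegrable _ _
  have hprim : Tendsto (fun n => ∫ y in (0 : ℝ)..(a n : ℝ) / n, F p₀ y) atTop
      (𝓝 (∫ y in (0 : ℝ)..α, F p₀ y)) :=
    ((intervalIntegral.continuous_primitive hint 0).tendsto α).comp haα
  have hdiff : Tendsto (fun n : ℕ =>
      (∑ j ∈ range (a n), F (p n) ((j + 1 : ℕ) * (n : ℝ)⁻¹) * (n : ℝ)⁻¹)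
      - ∫ y in (0 : ℝ)..(a n : ℝ) / n, F p₀ y) atTop (𝓝 0) := by
    rw [Metric.tendsto_atTop']
    intro ε hε
    obtain ⟨δ, hδ, hu⟩ := Metric.uniformContinuousOn_iff.1
      (isCompact_Icc.uniformContinuousOn_of_continuous (s := Set.Icc (0 : ℝ) 1) hF0.continuousOn)
      (ε / 4) (by positivity)
    have h1 := eventually_uniform_Icc hF hp (ε := ε / 4) (by positivity)
    have h2 : ∀ᶠ n : ℕ in atTop, (n : ℝ)⁻¹ < δ :=
      tendsto_inv_atTop_nhds_zero_nat.eventually (gt_mem_nhds hδ)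
    obtain ⟨N, hN⟩ := eventually_atTop.1 (h1.and (h2.and (eventually_ge_atTop 1)))
    refine ⟨N, fun n hn => ?_⟩
    obtain ⟨hn1, hn2, hn3⟩ := hN n hn.le
    have hn0 : (0 : ℝ) < n := by exact_mod_cast hn3
    have han : (a n : ℝ) ≤ n := by exact_mod_cast ha n hn3
    have hsum := intervalIntegral.sum_integral_adjacent_intervals (f := F p₀) (μ := volume)
      (a := fun j : ℕ => (j : ℝ) * (n : ℝ)⁻¹) (n := a n) (fun k _ => hint _ _)
    simp only [Nat.cast_zero, zero_mul] at hsum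
    rw [Real.dist_eq, sub_zero, div_eq_mul_inv, ← hsum, ← sum_sub_distrib]
    have hterm : ∀ j ∈ range (a n), |F (p n) ((j + 1 : ℕ) * (n : ℝ)⁻¹) * (n : ℝ)⁻¹
        - ∫ y in ((j : ℕ) * (n : ℝ)⁻¹)..((j + 1 : ℕ) * (n : ℝ)⁻¹), F p₀ y| ≤ ε / 2 * (n : ℝ)⁻¹ := by
      intro j hj
      have hj' : ((j + 1 : ℕ) : ℝ) ≤ n := by
        exact_mod_cast (Nat.succ_le_of_lt (mem_range.1 hj)).trans (ha n hn3)
      have hle : (j : ℝ) * (n : ℝ)⁻¹ ≤ (j + 1 : ℕ) * (n : ℝ)⁻¹ := by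
        gcongr; simp
      have hlen : ((j + 1 : ℕ) : ℝ) * (n : ℝ)⁻¹ - j * (n : ℝ)⁻¹ = (n : ℝ)⁻¹ := by push_cast; ring
      have hr : ((j + 1 : ℕ) : ℝ) * (n : ℝ)⁻¹ ≤ 1 := by
        rw [← div_eq_mul_inv]; exact div_le_one_of_le₀ hj' hn0.le
      have hl : 0 ≤ (j : ℝ) * (n : ℝ)⁻¹ := by positivity
      have hc : F (p n) ((j + 1 : ℕ) * (n : ℝ)⁻¹) * (n : ℝ)⁻¹
          = ∫ _ in ((j : ℕ) * (n : ℝ)⁻¹)..((j + 1 : ℕ) * (n : ℝ)⁻¹),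
            F (p n) ((j + 1 : ℕ) * (n : ℝ)⁻¹) := by
        rw [intervalIntegral.integral_const, hlen, smul_eq_mul, mul_comm]
      rw [hc, ← intervalIntegral.integral_sub intervalIntegrable_const (hint _ _),
        ← Real.norm_eq_abs]
      refine (intervalIntegral.norm_integral_le_of_norm_le_const (C := ε / 2) fun y hy => ?_).trans ?_
      · rw [Set.uIoc_of_le hle] at hy
        have e1 := hn1 (((j + 1 : ℕ) : ℝ) * (n : ℝ)⁻¹) ⟨hl.trans hle, hr⟩
        have e2 := hu (((j + 1 : ℕ) : ℝ) * (n : ℝ)⁻¹) ⟨hl.trans hle, hr⟩ y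
          ⟨hl.trans hy.1.le, hy.2.trans hr⟩ (by
            rw [Real.dist_eq, abs_of_nonneg (by linarith [hy.2])]; linarith [hy.1])
        rw [Real.dist_eq] at e2
        rw [Real.norm_eq_abs]
        have := abs_sub_le (F (p n) (((j + 1 : ℕ) : ℝ) * (n : ℝ)⁻¹))
          (F p₀ (((j + 1 : ℕ) : ℝ) * (n : ℝ)⁻¹)) (F p₀ y)
        linarith
      · rw [hlen, abs_of_pos (by positivity)]
    calc _ ≤ ∑ j ∈ range (a n), _ := abs_sum_le_sum_abs _ _
      _ ≤ ∑ j ∈ range (a n), ε / 2 * (n : ℝ)⁻¹ := sum_le_sum hterm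
      _ = ε / 2 * (a n * (n : ℝ)⁻¹) := by rw [sum_const, card_range, nsmul_eq_mul]; ring
      _ ≤ ε / 2 * 1 := by
        gcongr
        rw [← div_eq_mul_inv]; exact div_le_one_of_le₀ han hn0.le
      _ < ε := by linarith
  simpa using hdiff.add hprim

/-- The limiting density of `[π a] / [n]` on `[0, 1]`. -/
noncomputable def quantileDensity (β α w : ℝ) : ℝ :=
  Real.exp (-(β * α)) / (1 - w * (1 - Real.exp (-(β * α)))) ^ 2

lemma quantileDensity_denom_pos (β α : ℝ) {w : ℝ} (hw : w ∈ Set.Icc (0 : ℝ) 1) :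
    0 < 1 - w * (1 - Real.exp (-(β * α))) := by
  have := Real.exp_pos (-(β * α))
  rcases hw.2.lt_or_eq with h | rfl
  · nlinarith [hw.1, mul_nonneg hw.1 this.le]
  · linarith

lemma continuousOn_quantileDensity (β α : ℝ) :
    ContinuousOn (quantileDensity β α) (Set.Icc 0 1) := by
  refine ContinuousOn.div (by fun_prop) (by fun_prop) fun w hw => ?_
  exact pow_ne_zero _ (quantileDensity_denom_pos β α hw).ne'

lemma expInt_div_mem_Icc (β : ℝ) {c y : ℝ} (hc : 0 < c) (hy : y ∈ Set.Icc 0 c) :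
    expInt β y / expInt β c ∈ Set.Icc (0 : ℝ) 1 := by
  have h0 := expInt_pos β hc
  refine ⟨div_nonneg ?_ h0.le, div_le_one_of_le₀ ((strictMono_expInt β).monotone hy.2) h0.le⟩
  simpa [expInt_zero_right] using (strictMono_expInt β).monotone hy.1

lemma integral_comp_expInt (β : ℝ) {c : ℝ} (hc : 0 < c) {g : ℝ → ℝ}
    (hg : ContinuousOn g (Set.Icc 0 1)) :
    ∫ y in (0 : ℝ)..c, g (expInt β y / expInt β c) * (Real.exp (-(β * y)) / expInt β c)
      = ∫ w in (0 : ℝ)..1, g w := by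
  have h := intervalIntegral.integral_comp_mul_deriv'' (a := 0) (b := c)
    (f := fun y => expInt β y / expInt β c) (f' := fun y => Real.exp (-(β * y)) / expInt β c)
    (g := g) ((continuous_expInt_right β).div_const _).continuousOn
    (fun y _ => ((hasDerivAt_expInt β y).div_const _).hasDerivWithinAt)
    (by fun_prop)
    (hg.mono (by
      rintro _ ⟨y, hy, rfl⟩
      rw [Set.uIcc_of_le hc.le] at hy
      exact expInt_div_mem_Icc β hc hy))
  simpa [expInt_zero_right, (expInt_pos β hc).ne'] using h

/-- The limit of the normalised `q`-rising factorial moments of a truncated geometric law. -/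
lemma integral_quantile (β : ℝ) (k : ℕ) {α : ℝ} (hα : 0 < α) :
    (∫ y in (0 : ℝ)..α, Real.exp (-(β * (α - y))) * expInt β y ^ k) / expInt β α ^ (k + 1)
      = ∫ w in (0 : ℝ)..1, w ^ k * quantileDensity β α w := by
  rw [← integral_comp_expInt β hα (g := fun w => w ^ k * quantileDensity β α w)
    ((continuousOn_id.pow k).mul (continuousOn_quantileDensity β α)),
    ← intervalIntegral.integral_div]
  congr 1
  ext y
  have h0 := (expInt_pos β hα).ne'
  have h1 : 1 - expInt β y / expInt β α * (1 - Real.exp (-(β * α))) = Real.exp (-(β * y)) := by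
    rw [← mul_expInt β α]
    field_simp
    rw [mul_comm, mul_expInt]
    ring
  simp only [quantileDensity, h1]
  rw [mul_sub, neg_sub, Real.exp_sub, Real.exp_neg, Real.exp_neg, div_pow, pow_succ]
  field_simp

lemma mallowsU_eq (β α y : ℝ) :
    mallowsU α y β = quantileDensity β α (expInt β y / expInt β 1)
      * (Real.exp (-(β * y)) / expInt β 1) := by
  rcases eq_or_ne β 0 with rfl | hβ
  · simp [mallowsU, quantileDensity, expInt_zero_left]
  have hE : ∀ t, expInt β t = (1 - Real.exp (-(β * t))) / β := fun t => by
    rw [← mul_expInt, mul_div_cancel_left₀ _ hβ]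
  have hs1 : expInt β 1 ≠ 0 := (expInt_pos β one_pos).ne'
  rw [hE, mul_one] at hs1
  have hs1' : 1 - Real.exp (-β) ≠ 0 := fun h => hs1 (by rw [h, zero_div])
  set s := Real.exp (β / 4) with hs
  set A := Real.exp (β * α / 2) with hA
  set B := Real.exp (β * y / 2) with hB
  have s0 : s ≠ 0 := (Real.exp_pos _).ne'
  have A0 : A ≠ 0 := (Real.exp_pos _).ne'
  have B0 : B ≠ 0 := (Real.exp_pos _).ne'
  have eA : Real.exp (-(β * α)) = (A ^ 2)⁻¹ := by
    rw [hA, ← Real.exp_nat_mul, ← Real.exp_neg]; push_cast; ring_nf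
  have eB : Real.exp (-(β * y)) = (B ^ 2)⁻¹ := by
    rw [hB, ← Real.exp_nat_mul, ← Real.exp_neg]; push_cast; ring_nf
  have es : Real.exp (-β) = (s ^ 4)⁻¹ := by
    rw [hs, ← Real.exp_nat_mul, ← Real.exp_neg]; push_cast; ring_nf
  have es' : Real.exp (-β / 4) = s⁻¹ := by rw [hs, ← Real.exp_neg]; ring_nf
  have esinh : Real.sinh (β / 2) = (s ^ 2 - (s ^ 2)⁻¹) / 2 := by
    rw [Real.sinh_eq, hs, ← Real.exp_nat_mul, ← Real.exp_neg]; push_cast; ring_nf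
  have ec1 : Real.cosh (β * (α - y) / 2) = (A / B + B / A) / 2 := by
    rw [Real.cosh_eq, hA, hB, ← Real.exp_sub, ← Real.exp_sub]; ring_nf
  have ec2 : Real.cosh (β * (α + y - 1) / 2) = (A * B / s ^ 2 + s ^ 2 / (A * B)) / 2 := by
    rw [Real.cosh_eq, hA, hB, hs, ← Real.exp_add, ← Real.exp_nat_mul, ← Real.exp_sub,
      ← Real.exp_sub]
    push_cast
    ring_nf
  rw [mallowsU, if_neg hβ, quantileDensity, hE, hE, mul_one, es', esinh, ec1, ec2, eA, eB, es]
  rw [es] at hs1'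
  set N := (B ^ 2)⁻¹ + (A ^ 2)⁻¹ - (s ^ 4)⁻¹ - (A ^ 2)⁻¹ * (B ^ 2)⁻¹ with hN
  have d1 : s * ((A / B + B / A) / 2) - s⁻¹ * ((A * B / s ^ 2 + s ^ 2 / (A * B)) / 2)
      = s * A * B / 2 * N := by
    rw [hN]; field_simp; ring
  have d2 : 1 - (1 - (B ^ 2)⁻¹) / β / ((1 - (s ^ 4)⁻¹) / β) * (1 - (A ^ 2)⁻¹)
      = N / (1 - (s ^ 4)⁻¹) := by
    rw [div_div_div_cancel_right₀ hβ, eq_div_iff hs1', sub_mul, mul_right_comm,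
      div_mul_cancel₀ _ hs1', hN]
    ring
  rw [d1, d2]
  have e4 : s ^ 2 - (s ^ 2)⁻¹ = s ^ 2 * (1 - (s ^ 4)⁻¹) := by field_simp
  rw [e4]
  rcases eq_or_ne N 0 with h0 | h0
  · simp [h0]
  generalize 1 - (s ^ 4)⁻¹ = q at *
  field_simp

lemma tendsto_one_of_mul_one_sub {q : ℕ → ℝ} {β : ℝ}
    (hβ : Tendsto (fun n : ℕ => (n : ℝ) * (1 - q n)) atTop (𝓝 β)) : Tendsto q atTop (𝓝 1) := by
  have h := (tendsto_inv_atTop_nhds_zero_nat (𝕜 := ℝ)).mul hβ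
  rw [zero_mul] at h
  have h2 := h.const_sub 1
  rw [sub_zero] at h2
  refine h2.congr' ?_
  filter_upwards [eventually_ge_atTop 1] with n hn
  have : (n : ℝ) ≠ 0 := by positivity
  field_simp
  ring

lemma tendsto_neg_mul_log {q : ℕ → ℝ} (hq : ∀ n, 0 < q n) {β : ℝ}
    (hβ : Tendsto (fun n : ℕ => (n : ℝ) * (1 - q n)) atTop (𝓝 β)) :
    Tendsto (fun n : ℕ => -((n : ℝ) * Real.log (q n))) atTop (𝓝 β) := by
  have h := hβ.div (tendsto_one_of_mul_one_sub hβ) one_ne_zero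
  rw [div_one] at h
  refine tendsto_of_tendsto_of_tendsto_of_le_of_le hβ h (fun n => ?_) fun n => ?_
  · have := Real.log_le_sub_one_of_pos (hq n)
    have hn : (0 : ℝ) ≤ n := n.cast_nonneg
    simp only
    nlinarith
  · have h1 := Real.one_sub_inv_le_log_of_pos (hq n)
    have hn : (0 : ℝ) ≤ n := n.cast_nonneg
    have h2 : (n : ℝ) * (1 - q n) / q n = n * ((q n)⁻¹ - 1) := by
      field_simp [(hq n).ne']
    simp only [Pi.div_apply]
    rw [h2]
    nlinarith

/-- The parameters of `expRising` corresponding to `qRising q` at mesh `1 / n`. -/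
noncomputable def risingParam (q : ℝ) (n : ℕ) : ℝ × ℝ × ℝ :=
  (-(n * Real.log q), (n : ℝ)⁻¹, (expInt (-(n * Real.log q) * (n : ℝ)⁻¹) 1)⁻¹)

lemma tendsto_risingParam {q : ℕ → ℝ} (hq : ∀ n, 0 < q n) {β : ℝ}
    (hβ : Tendsto (fun n : ℕ => (n : ℝ) * (1 - q n)) atTop (𝓝 β)) :
    Tendsto (fun n => risingParam (q n) n) atTop (𝓝 (β, 0, 1)) := by
  have hb := tendsto_neg_mul_log hq hβ
  have hh := tendsto_inv_atTop_nhds_zero_nat (𝕜 := ℝ)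
  refine hb.prodMk_nhds (hh.prodMk_nhds ?_)
  have h := (continuous_expInt.tendsto (β * 0, 1)).comp ((hb.mul hh).prodMk_nhds tendsto_const_nhds)
  simp only [mul_zero, expInt_zero_left] at h
  simpa using h.inv₀ one_ne_zero

lemma exp_risingParam {q : ℝ} (hq : 0 < q) {n : ℕ} (hn : 1 ≤ n) :
    Real.exp (-((risingParam q n).1 * (n : ℝ)⁻¹)) = q := by
  have : (n : ℝ) ≠ 0 := by positivity
  have h : -((risingParam q n).1 * (n : ℝ)⁻¹) = Real.log q := by
    simp only [risingParam]
    field_simp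
  rw [h, Real.exp_log hq]

lemma qRising_mul_inv_pow {q : ℝ} (hq : 0 < q) {n : ℕ} (hn : 1 ≤ n) (k j : ℕ) :
    qRising q k j * (n : ℝ)⁻¹ ^ k = expRising k (risingParam q n) (j * (n : ℝ)⁻¹) := by
  have hn' : (n : ℝ)⁻¹ ≠ 0 := by positivity
  have h := qRising_exp_mul (risingParam q n).1 hn' k j
  rwa [exp_risingParam hq hn] at h

lemma pow_sub_eq_exp {q : ℝ} (hq : 0 < q) {n : ℕ} (hn : 1 ≤ n) {a j : ℕ} (hj : j ≤ a) :
    q ^ (a - j) = Real.exp (-((risingParam q n).1 * (a * (n : ℝ)⁻¹ - j * (n : ℝ)⁻¹))) := by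
  conv_lhs => rw [← exp_risingParam hq hn, ← Real.exp_nat_mul, Nat.cast_sub hj]
  ring_nf

lemma tendsto_truncated_geometric_of_pos {q : ℕ → ℝ} (hq : ∀ n, 0 < q n) {β : ℝ}
    (hβ : Tendsto (fun n : ℕ => (n : ℝ) * (1 - q n)) atTop (𝓝 β))
    {a : ℕ → ℕ} (ha : ∀ n, 1 ≤ n → a n ≤ n) {α : ℝ} (hα : 0 < α)
    (haα : Tendsto (fun n => (a n : ℝ) / n) atTop (𝓝 α)) (k : ℕ) :
    Tendsto (fun n => (∑ j ∈ range (a n), q n ^ (a n - (j + 1)) * qRising (q n) k (j + 1))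
        / qRising (q n) (k + 1) (a n)) atTop
      (𝓝 (∫ w in (0 : ℝ)..1, w ^ k * quantileDensity β α w)) := by
  have hp := tendsto_risingParam hq hβ
  have hF : Continuous fun x : (ℝ × ℝ × ℝ × ℝ) × ℝ =>
      Real.exp (-(x.1.2.1 * (x.1.1 - x.2))) * expRising k x.1.2 x.2 :=
    (by fun_prop : Continuous fun x : (ℝ × ℝ × ℝ × ℝ) × ℝ =>
      Real.exp (-(x.1.2.1 * (x.1.1 - x.2)))).mul
      ((continuous_expRising k).comp
        (by fun_prop : Continuous fun x : (ℝ × ℝ × ℝ × ℝ) × ℝ => (x.1.2, x.2)))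
  have hnum := tendsto_riemann_sum
    (F := fun (x : ℝ × ℝ × ℝ × ℝ) y => Real.exp (-(x.2.1 * (x.1 - y))) * expRising k x.2 y)
    hF (haα.prodMk_nhds hp) ha haα
  have hden := ((continuous_expRising (k + 1)).tendsto _).comp (hp.prodMk_nhds haα)
  simp only [expRising_limit] at hnum hden
  rw [← integral_quantile β k hα]
  refine (hnum.div hden (pow_pos (expInt_pos β hα) _).ne').congr' ?_
  filter_upwards [eventually_ge_atTop 1] with n hn
  have hn' : (n : ℝ)⁻¹ ≠ 0 := by positivity
  simp only [Pi.div_apply, Function.comp_apply, div_eq_mul_inv (a n : ℝ)]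
  rw [← qRising_mul_inv_pow (hq n) hn (k + 1) (a n),
    ← mul_div_mul_right _ (qRising (q n) (k + 1) (a n)) (pow_ne_zero (k + 1) hn')]
  congr 1
  rw [sum_mul]
  refine sum_congr rfl fun j hj => ?_
  rw [← qRising_mul_inv_pow (hq n) hn k (j + 1),
    ← pow_sub_eq_exp (hq n) hn (Nat.succ_le_of_lt (mem_range.1 hj))]
  ring

lemma tendsto_truncated_geometric_of_zero {q : ℕ → ℝ} (hq : ∀ n, 0 < q n) {β : ℝ}
    (hβ : Tendsto (fun n : ℕ => (n : ℝ) * (1 - q n)) atTop (𝓝 β))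
    {a : ℕ → ℕ} (ha : ∀ n, 1 ≤ n → 1 ≤ a n)
    (haα : Tendsto (fun n => (a n : ℝ) / n) atTop (𝓝 0)) (k : ℕ) :
    Tendsto (fun n => (∑ j ∈ range (a n), q n ^ (a n - (j + 1)) * qRising (q n) k (j + 1))
        / qRising (q n) (k + 1) (a n)) atTop (𝓝 (1 / ((k : ℝ) + 1))) := by
  have hq1 := tendsto_one_of_mul_one_sub hβ
  have hden : Tendsto (fun n => qInt (q n) (k + 1)) atTop (𝓝 ((k : ℝ) + 1)) := by
    have hc : Continuous fun x : ℝ => qInt x (k + 1) := by unfold qInt; fun_prop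
    have h := (hc.tendsto 1).comp hq1
    have h1 : qInt 1 (k + 1) = (k : ℝ) + 1 := by simp [qInt]
    rwa [h1] at h
  have hbound : Tendsto
      (fun n : ℕ => Real.exp (|(risingParam (q n) n).1| * ((a n : ℝ) / n)) - 1) atTop (𝓝 0) := by
    have h := (tendsto_neg_mul_log hq hβ).abs.mul haα
    rw [mul_zero] at h
    have h2 := ((Real.continuous_exp.tendsto 0).comp h).sub_const 1
    rwa [Real.exp_zero, sub_self] at h2
  have hmain : Tendsto (fun n =>
      (∑ j ∈ range (a n), q n ^ (a n - (j + 1)) * qRising (q n) k (j + 1))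
        / qRising (q n) (k + 1) (a n) * qInt (q n) (k + 1) - 1) atTop (𝓝 0) := by
    refine squeeze_zero_norm' ?_ hbound
    filter_upwards [eventually_ge_atTop 1] with n hn
    have hR := qRising_pos (hq n) (k + 1) (ha n hn)
    have hI := qInt_pos (hq n) (Nat.succ_pos k)
    have hsum := sum_pow_mul_qRising (q n) k (a n)
    set δ := Real.exp (|(risingParam (q n) n).1| * ((a n : ℝ) / n)) - 1 with hδ
    have hterm : ∀ j ∈ range (a n),
        |q n ^ (a n - (j + 1)) * qRising (q n) k (j + 1) - q n ^ j * qRising (q n) k (j + 1)|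
          ≤ δ * (q n ^ j * qRising (q n) k (j + 1)) := by
      intro j hj
      have hj' : j + 1 ≤ a n := Nat.succ_le_of_lt (mem_range.1 hj)
      set t := -((risingParam (q n) n).1 * ((a n : ℝ) * (n : ℝ)⁻¹ - (j + 1 : ℕ) * (n : ℝ)⁻¹
        - j * (n : ℝ)⁻¹)) with ht
      have e : q n ^ (a n - (j + 1)) = Real.exp t * q n ^ j := by
        have h2 := pow_sub_eq_exp (hq n) hn (Nat.zero_le j)
        rw [Nat.sub_zero] at h2
        rw [pow_sub_eq_exp (hq n) hn hj', h2, ← Real.exp_add, ht]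
        push_cast
        ring_nf
      have habs : |t| ≤ |(risingParam (q n) n).1| * ((a n : ℝ) / n) := by
        rw [ht, abs_neg, abs_mul, div_eq_mul_inv, ← sub_mul, ← sub_mul, abs_mul,
          abs_of_nonneg (by positivity : (0 : ℝ) ≤ (n : ℝ)⁻¹)]
        gcongr
        have : ((j + 1 : ℕ) : ℝ) ≤ a n := by exact_mod_cast hj'
        push_cast at this ⊢
        rw [abs_le]
        have : (0 : ℝ) ≤ j := j.cast_nonneg
        constructor <;> linarith
      have hexp : |Real.exp t - 1| ≤ δ := by
        have h3 := Real.exp_le_exp.2 ((le_abs_self t).trans habs)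
        have h4 := Real.exp_le_exp.2 ((neg_le_abs t).trans habs)
        have h5 : 2 ≤ Real.exp t + Real.exp (-t) := by
          have := Real.one_le_cosh t
          rw [Real.cosh_eq] at this
          linarith
        rw [abs_le]
        constructor <;> linarith
      have hpos : 0 ≤ q n ^ j * qRising (q n) k (j + 1) :=
        mul_nonneg (pow_pos (hq n) _).le (qRising_pos (hq n) _ (Nat.succ_pos j)).le
      rw [e, mul_assoc, ← sub_one_mul, abs_mul, abs_of_nonneg hpos]
      exact mul_le_mul_of_nonneg_right hexp hpos
    have hS : |(∑ j ∈ range (a n), q n ^ (a n - (j + 1)) * qRising (q n) k (j + 1))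
        - ∑ j ∈ range (a n), q n ^ j * qRising (q n) k (j + 1)|
        ≤ δ * ∑ j ∈ range (a n), q n ^ j * qRising (q n) k (j + 1) := by
      rw [← sum_sub_distrib, mul_sum]
      exact (abs_sum_le_sum_abs _ _).trans (sum_le_sum hterm)
    have e : (∑ j ∈ range (a n), q n ^ (a n - (j + 1)) * qRising (q n) k (j + 1))
        / qRising (q n) (k + 1) (a n) * qInt (q n) (k + 1) - 1
        = ((∑ j ∈ range (a n), q n ^ (a n - (j + 1)) * qRising (q n) k (j + 1))
        - ∑ j ∈ range (a n), q n ^ j * qRising (q n) k (j + 1)) * qInt (q n) (k + 1)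
          / qRising (q n) (k + 1) (a n) := by
      rw [sub_mul, hsum]
      field_simp
    rw [Real.norm_eq_abs, e, abs_div, abs_mul, abs_of_pos hR, abs_of_pos hI, div_le_iff₀ hR, ← hsum,
      ← mul_assoc]
    exact mul_le_mul_of_nonneg_right hS hI.le
  have h := (hmain.add_const 1).div hden (by positivity)
  rw [zero_add] at h
  refine h.congr fun n => ?_
  have hI := (qInt_pos (hq n) (Nat.succ_pos k)).ne'
  simp only [Pi.div_apply, sub_add_cancel]
  rw [mul_div_assoc, div_self hI, mul_one]

lemma tendsto_truncated_geometric {q : ℕ → ℝ} (hq : ∀ n, 0 < q n) {β : ℝ}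
    (hβ : Tendsto (fun n : ℕ => (n : ℝ) * (1 - q n)) atTop (𝓝 β))
    {a : ℕ → ℕ} (ha : ∀ n, 1 ≤ n → 1 ≤ a n ∧ a n ≤ n) {α : ℝ} (hα : 0 ≤ α)
    (haα : Tendsto (fun n => (a n : ℝ) / n) atTop (𝓝 α)) (k : ℕ) :
    Tendsto (fun n => (∑ j ∈ range (a n), q n ^ (a n - (j + 1)) * qRising (q n) k (j + 1))
        / qRising (q n) (k + 1) (a n)) atTop
      (𝓝 (∫ w in (0 : ℝ)..1, w ^ k * quantileDensity β α w)) := by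
  rcases hα.eq_or_lt with rfl | hα
  · have h := tendsto_truncated_geometric_of_zero hq hβ (fun n hn => (ha n hn).1) haα k
    simpa [quantileDensity, integral_pow] using h
  · exact tendsto_truncated_geometric_of_pos hq hβ (fun n hn => (ha n hn).2) hα haα k

lemma permAct_div_mem_Icc {n a : ℕ} (h : 1 ≤ a ∧ a ≤ n) (π : Equiv.Perm (Fin n)) :
    (permAct n π a : ℝ) / n ∈ Set.Icc (0 : ℝ) 1 :=
  ⟨by positivity, div_le_one_of_le₀ (by exact_mod_cast (permAct_mem_Icc h.1 h.2 π).2)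
    (by positivity)⟩

lemma integral_expInt_pow_mul_mallowsU (β α : ℝ) (k : ℕ) :
    ∫ y in (0 : ℝ)..1, expInt β y ^ k * mallowsU α y β
      = expInt β 1 ^ k * ∫ w in (0 : ℝ)..1, w ^ k * quantileDensity β α w := by
  rw [← integral_comp_expInt β one_pos (g := fun w => w ^ k * quantileDensity β α w)
    ((continuousOn_id.pow k).mul (continuousOn_quantileDensity β α)),
    ← intervalIntegral.integral_const_mul]
  congr 1
  ext y
  have h0 := (expInt_pos β one_pos).ne'
  rw [mallowsU_eq, div_pow]
  field_simp

lemma tendsto_mallowsExp_expInt_pow {q : ℕ → ℝ} (hq : ∀ n, 0 < q n) {β : ℝ}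
    (hβ : Tendsto (fun n : ℕ => (n : ℝ) * (1 - q n)) atTop (𝓝 β))
    {a : ℕ → ℕ} (ha : ∀ n, 1 ≤ n → 1 ≤ a n ∧ a n ≤ n) {α : ℝ} (hα : 0 ≤ α)
    (haα : Tendsto (fun n => (a n : ℝ) / n) atTop (𝓝 α)) (k : ℕ) :
    Tendsto (fun n => mallowsExp n (q n) fun π => expInt β ((permAct n π (a n) : ℝ) / n) ^ k) atTop
      (𝓝 (∫ y in (0 : ℝ)..1, expInt β y ^ k * mallowsU α y β)) := by
  have hp := tendsto_risingParam hq hβ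
  have hh := tendsto_inv_atTop_nhds_zero_nat (𝕜 := ℝ)
  have hend : Tendsto (fun n : ℕ => expRising k (risingParam (q n) n) (1 + (n : ℝ)⁻¹)) atTop
      (𝓝 (expInt β 1 ^ k)) := by
    have h := ((continuous_expRising k).tendsto _).comp (hp.prodMk_nhds (hh.const_add 1))
    rwa [add_zero, expRising_limit] at h
  have hmom := hend.mul (tendsto_truncated_geometric hq hβ ha hα haα k)
  rw [← integral_expInt_pow_mul_mallowsU] at hmom
  have hdiff : Tendsto (fun n =>
      mallowsExp n (q n) (fun π => expInt β ((permAct n π (a n) : ℝ) / n) ^ k)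
      - mallowsExp n (q n) (fun π =>
        expRising k (risingParam (q n) n) ((permAct n π (a n) : ℝ) / n))) atTop (𝓝 0) := by
    rw [Metric.tendsto_atTop']
    intro ε hε
    obtain ⟨N, hN⟩ := eventually_atTop.1
      ((eventually_uniform_Icc (continuous_expRising k) hp (half_pos hε)).and
        (eventually_ge_atTop 1))
    refine ⟨N, fun n hn => ?_⟩
    obtain ⟨h1, h2⟩ := hN n hn.le
    rw [Real.dist_eq, sub_zero]
    refine (abs_mallowsExp_sub_le (hq n) fun π => ?_).trans_lt (half_lt_self hε)
    have := h1 _ (permAct_div_mem_Icc (ha n h2) π)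
    rw [expRising_limit, abs_sub_comm] at this
    exact this.le
  have h := hdiff.add hmom
  rw [zero_add] at h
  refine h.congr' ?_
  filter_upwards [eventually_ge_atTop 1] with n hn
  have hn' : (n : ℝ) ≠ 0 := by positivity
  have e1 : (1 + (n : ℝ)⁻¹) = (n + 1 : ℕ) * (n : ℝ)⁻¹ := by push_cast; field_simp
  have e2 : mallowsExp n (q n) (fun π =>
        expRising k (risingParam (q n) n) ((permAct n π (a n) : ℝ) / n))
      = mallowsExp n (q n) (fun π => qRising (q n) k (permAct n π (a n))) * (n : ℝ)⁻¹ ^ k := by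
    simp only [mallowsExp, sum_mul, div_eq_mul_inv, ← qRising_mul_inv_pow (hq n) hn, mul_assoc]
  rw [e1, ← qRising_mul_inv_pow (hq n) hn, e2, mallowsExp_qRising (hq n) k (ha n hn).1 (ha n hn).2]
  ring

lemma mallowsU_nonneg (β α : ℝ) (y : ℝ) : 0 ≤ mallowsU α y β := by
  rw [mallowsU_eq]
  exact mul_nonneg (div_nonneg (Real.exp_pos _).le (sq_nonneg _))
    (div_nonneg (Real.exp_pos _).le (expInt_pos β one_pos).le)

lemma continuousOn_mallowsU (β α : ℝ) :
    ContinuousOn (fun y => mallowsU α y β) (Set.Icc 0 1) := by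
  simp only [mallowsU_eq]
  refine ContinuousOn.mul ((continuousOn_quantileDensity β α).comp
    ((continuous_expInt_right β).div_const _).continuousOn fun y hy =>
      expInt_div_mem_Icc β one_pos hy) ?_
  fun_prop

/-- Polynomials in `expInt β` are uniformly dense among continuous functions on `[0, 1]`. -/
lemma exists_polynomial_expInt_near (β : ℝ) (f : C(ℝ, ℝ)) {ε : ℝ} (hε : 0 < ε) :
    ∃ P : Polynomial ℝ, ∀ y ∈ Set.Icc (0 : ℝ) 1, |P.eval (expInt β y) - f y| < ε := by
  let w : C(Set.Icc (0 : ℝ) 1, ℝ) :=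
    ⟨fun y => expInt β y, (continuous_expInt_right β).comp continuous_subtype_val⟩
  have hsep : (Algebra.adjoin ℝ {w}).SeparatesPoints := fun x y hxy =>
    ⟨w, ⟨w, Algebra.self_mem_adjoin_singleton ℝ w, rfl⟩, fun h =>
      hxy (Subtype.ext ((strictMono_expInt β).injective h))⟩
  obtain ⟨⟨g, hg⟩, hgf⟩ :=
    ContinuousMap.exists_mem_subalgebra_near_continuous_of_separatesPoints _ hsep
      (fun y => f y) (f.continuous.comp continuous_subtype_val) ε hε
  rw [Algebra.adjoin_singleton_eq_range_aeval] at hg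
  obtain ⟨P, rfl⟩ := hg
  refine ⟨P, fun y hy => ?_⟩
  have h : ‖Polynomial.aeval w P ⟨y, hy⟩ - f y‖ < ε := hgf ⟨y, hy⟩
  rwa [Polynomial.aeval_continuousMap_apply] at h

lemma tendsto_mallowsExp_polynomial {q : ℕ → ℝ} (hq : ∀ n, 0 < q n) {β : ℝ}
    (hβ : Tendsto (fun n : ℕ => (n : ℝ) * (1 - q n)) atTop (𝓝 β))
    {a : ℕ → ℕ} (ha : ∀ n, 1 ≤ n → 1 ≤ a n ∧ a n ≤ n) {α : ℝ} (hα : 0 ≤ α)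
    (haα : Tendsto (fun n => (a n : ℝ) / n) atTop (𝓝 α)) (P : Polynomial ℝ) :
    Tendsto (fun n => mallowsExp n (q n) fun π =>
        P.eval (expInt β ((permAct n π (a n) : ℝ) / n))) atTop
      (𝓝 (∫ y in (0 : ℝ)..1, P.eval (expInt β y) * mallowsU α y β)) := by
  have hU : ContinuousOn (fun y => mallowsU α y β) (Set.uIcc 0 1) := by
    rw [Set.uIcc_of_le zero_le_one]
    exact continuousOn_mallowsU β α
  have h := tendsto_finsetSum (range (P.natDegree + 1)) fun k _ =>
    (tendsto_mallowsExp_expInt_pow hq hβ ha hα haα k).const_mul (P.coeff k)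
  have e : ∫ y in (0 : ℝ)..1, P.eval (expInt β y) * mallowsU α y β
      = ∑ k ∈ range (P.natDegree + 1),
        P.coeff k * ∫ y in (0 : ℝ)..1, expInt β y ^ k * mallowsU α y β := by
    simp only [← intervalIntegral.integral_const_mul, Polynomial.eval_eq_sum_range, sum_mul]
    rw [intervalIntegral.integral_finsetSum]
    · simp only [mul_assoc]
    · intro k _
      exact (((continuous_expInt_right β).pow k).const_mul (P.coeff k)).continuousOn.mul hU
        |>.intervalIntegrable
  rw [e]
  refine h.congr fun n => ?_
  simp only [mallowsExp, mul_sum, Polynomial.eval_eq_sum_range]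
  rw [sum_comm]
  refine sum_congr rfl fun π _ => sum_congr rfl fun k _ => by ring

end Analysis

/-- **Theorem 1.1.** If `n(1-qₙ) → β` and `aₙ/n → a ∈ [0,1]` with `aₙ ∈ {1,…,n}`, then the law
of `π(aₙ)/n` under the `(n,qₙ)`-Mallows measure converges in distribution (tested against
bounded continuous functions) to the probability measure on `[0,1]` with density
`y ↦ u(a,y,β)`. -/
theorem mallows_one_point_convergence
    (q : ℕ → ℝ) (hq : ∀ n, 0 < q n) (β : ℝ)
    (hβ : Tendsto (fun n : ℕ => (n : ℝ) * (1 - q n)) atTop (nhds β))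
    (a : ℕ → ℕ) (ha : ∀ n : ℕ, 1 ≤ n → 1 ≤ a n ∧ a n ≤ n)
    (av : ℝ) (hav : av ∈ Set.Icc (0 : ℝ) 1)
    (haa : Tendsto (fun n : ℕ => (a n : ℝ) / n) atTop (nhds av)) :
    ∀ f : BoundedContinuousFunction ℝ ℝ,
      Tendsto (fun n : ℕ =>
          mallowsExp n (q n) (fun π => f ((permAct n π (a n) : ℝ) / n)))
        atTop
        (nhds (∫ y in Set.Icc (0 : ℝ) 1, f y * mallowsU av y β)) := by
  intro f
  rw [integral_Icc_eq_integral_Ioc, ← intervalIntegral.integral_of_le zero_le_one]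
  have hU : ContinuousOn (fun y => mallowsU av y β) (Set.uIcc 0 1) := by
    rw [Set.uIcc_of_le zero_le_one]
    exact continuousOn_mallowsU β av
  have hmass : ∫ y in (0 : ℝ)..1, mallowsU av y β = 1 := by
    have h := tendsto_mallowsExp_expInt_pow hq hβ ha hav.1 haa 0
    simp only [pow_zero, one_mul, mallowsExp, mul_one, sum_mallowsPMF _ (hq _)] at h
    exact tendsto_nhds_unique h tendsto_const_nhds
  rw [Metric.tendsto_atTop']
  intro ε hε
  obtain ⟨P, hP⟩ := exists_polynomial_expInt_near β (f : C(ℝ, ℝ)) (ε := ε / 3) (by positivity)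
  have hPc : Continuous fun y => P.eval (expInt β y) :=
    P.continuous.comp (continuous_expInt_right β)
  have hlim := Metric.tendsto_atTop.1 (tendsto_mallowsExp_polynomial hq hβ ha hav.1 haa P)
    (ε / 3) (by positivity)
  obtain ⟨N, hN⟩ := hlim
  refine ⟨N, fun n hn => ?_⟩
  have h1 := hN n hn.le
  have h2 : |mallowsExp n (q n) (fun π => P.eval (expInt β ((permAct n π (a n) : ℝ) / n)))
      - mallowsExp n (q n) (fun π => f ((permAct n π (a n) : ℝ) / n))| ≤ ε / 3 :=
    abs_mallowsExp_sub_le (hq n) fun π =>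
      (hP _ (permAct_div_mem_Icc (ha n (by omega)) π)).le
  have h3 : |(∫ y in (0 : ℝ)..1, P.eval (expInt β y) * mallowsU av y β)
      - ∫ y in (0 : ℝ)..1, f y * mallowsU av y β| ≤ ε / 3 := by
    have hi1 : IntervalIntegrable (fun y => P.eval (expInt β y) * mallowsU av y β) volume 0 1 :=
      (hPc.continuousOn.mul hU).intervalIntegrable
    have hi2 : IntervalIntegrable (fun y => f y * mallowsU av y β) volume 0 1 :=
      (f.continuous.continuousOn.mul hU).intervalIntegrable
    rw [← intervalIntegral.integral_sub hi1 hi2]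
    have hle := intervalIntegral.norm_integral_le_of_norm_le (a := (0 : ℝ)) (b := 1) (μ := volume)
      (f := fun y => P.eval (expInt β y) * mallowsU av y β - f y * mallowsU av y β)
      (g := fun y => ε / 3 * mallowsU av y β) zero_le_one
      (ae_of_all _ fun y hy => by
        rw [← sub_mul, norm_mul, Real.norm_eq_abs, Real.norm_of_nonneg (mallowsU_nonneg β av y)]
        exact mul_le_mul_of_nonneg_right (hP y ⟨hy.1.le, hy.2⟩).le (mallowsU_nonneg β av y))
      (continuousOn_const.mul hU).intervalIntegrable
    rwa [intervalIntegral.integral_const_mul, hmass, mul_one] at hle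
  rw [Real.dist_eq] at h1 ⊢
  rw [abs_lt] at h1 ⊢
  rw [abs_le] at h2 h3
  constructor <;> linarith
end

section
/- Fix β ∈ ℝ and write u(x,y) = u(x,y,β). For any a, c, d ∈ [0,1], one has −β·∫_c^d ( −∫_0^a u(x,y) dx + ∫_a^1 u(x,y) dx ) dy = ln( u(a,d) / u(a,c) ). -/
open Filter Finset MeasureTheory

/-- The function whose square is the denominator of `mallowsU x y β`. -/
noncomputable def mallowsDenom (x y β : ℝ) : ℝ :=
  Real.exp (β / 4) * Real.cosh (β * (x - y) / 2)
    - Real.exp (-β / 4) * Real.cosh (β * (x + y - 1) / 2)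

/-- The primitive of `x ↦ mallowsU x y β` that vanishes at `0`. -/
noncomputable def mallowsCDF (x y β : ℝ) : ℝ :=
  Real.exp (β / 4 - β * y / 2) * Real.sinh (β * x / 2) / mallowsDenom x y β

lemma mallowsU_eq_div {β : ℝ} (hβ : β ≠ 0) (x y : ℝ) :
    mallowsU x y β = (β / 2) * Real.sinh (β / 2) / mallowsDenom x y β ^ 2 := by
  simp only [mallowsU, mallowsDenom, hβ, if_false]

lemma mallowsDenom_eq (x y β : ℝ) :
    mallowsDenom x y β = Real.exp (β * x / 2 - β / 4) * Real.sinh (β * (1 - y) / 2)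
      + Real.exp (β / 4 - β * x / 2) * Real.sinh (β * y / 2) := by
  simp only [mallowsDenom, Real.cosh_eq, Real.sinh_eq, mul_div_assoc', mul_add, mul_sub,
    ← Real.exp_add]
  ring_nf

lemma mallowsDenom_ne_zero {β : ℝ} (hβ : β ≠ 0) (x : ℝ) {y : ℝ} (hy : y ∈ Set.Icc (0 : ℝ) 1) :
    mallowsDenom x y β ≠ 0 := by
  obtain ⟨hy0, hy1⟩ := hy
  have h1 := Real.exp_pos (β * x / 2 - β / 4)
  have h2 := Real.exp_pos (β / 4 - β * x / 2)
  rw [mallowsDenom_eq]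
  rcases lt_or_gt_of_ne hβ with hβ | hβ
  · apply ne_of_lt
    rcases hy0.eq_or_lt with rfl | hy0
    · have : Real.sinh (β * (1 - 0) / 2) < 0 := Real.sinh_neg_iff.2 (by linarith)
      simpa using mul_neg_of_pos_of_neg h1 this
    · have h3 : Real.sinh (β * (1 - y) / 2) ≤ 0 := Real.sinh_nonpos_iff.2 (by nlinarith)
      have h4 : Real.sinh (β * y / 2) < 0 := Real.sinh_neg_iff.2 (by nlinarith)
      exact add_neg_of_nonpos_of_neg (mul_nonpos_of_nonneg_of_nonpos h1.le h3)
        (mul_neg_of_pos_of_neg h2 h4)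
  · apply ne_of_gt
    rcases hy0.eq_or_lt with rfl | hy0
    · have : 0 < Real.sinh (β * (1 - 0) / 2) := Real.sinh_pos_iff.2 (by linarith)
      simpa using mul_pos h1 this
    · have h3 : 0 ≤ Real.sinh (β * (1 - y) / 2) := Real.sinh_nonneg_iff.2 (by nlinarith)
      have h4 : 0 < Real.sinh (β * y / 2) := Real.sinh_pos_iff.2 (by nlinarith)
      exact add_pos_of_nonneg_of_pos (mul_nonneg h1.le h3) (mul_pos h2 h4)

lemma hasDerivAt_mallowsDenom_left (x y β : ℝ) :
    HasDerivAt (fun x => mallowsDenom x y β)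
      (β / 2 * (Real.exp (β / 4) * Real.sinh (β * (x - y) / 2)
        - Real.exp (-β / 4) * Real.sinh (β * (x + y - 1) / 2))) x := by
  have h1 : HasDerivAt (fun x => β * (x - y) / 2) (β / 2) x := by
    simpa using (((hasDerivAt_id x).sub_const y).const_mul β).div_const 2
  have h2 : HasDerivAt (fun x => β * (x + y - 1) / 2) (β / 2) x := by
    simpa using ((((hasDerivAt_id x).add_const y).sub_const 1).const_mul β).div_const 2
  exact ((h1.cosh.const_mul (Real.exp (β / 4))).sub
    (h2.cosh.const_mul (Real.exp (-β / 4)))).congr_deriv (by ring)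

lemma hasDerivAt_mallowsDenom_right (x y β : ℝ) :
    HasDerivAt (fun y => mallowsDenom x y β)
      (β / 2 * (mallowsDenom x y β
        - 2 * (Real.exp (β / 4 - β * y / 2) * Real.sinh (β * x / 2)))) y := by
  have h1 : HasDerivAt (fun y => β * (x - y) / 2) (-β / 2) y := by
    simpa using (((hasDerivAt_id y).const_sub x).const_mul β).div_const 2
  have h2 : HasDerivAt (fun y => β * (x + y - 1) / 2) (β / 2) y := by
    simpa using ((((hasDerivAt_id y).const_add x).sub_const 1).const_mul β).div_const 2
  refine ((h1.cosh.const_mul (Real.exp (β / 4))).sub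
    (h2.cosh.const_mul (Real.exp (-β / 4)))).congr_deriv ?_
  have key : -(Real.exp (β / 4) * Real.sinh (β * (x - y) / 2))
      - Real.exp (-β / 4) * Real.sinh (β * (x + y - 1) / 2)
      = mallowsDenom x y β - 2 * (Real.exp (β / 4 - β * y / 2) * Real.sinh (β * x / 2)) := by
    simp only [mallowsDenom, Real.cosh_eq, Real.sinh_eq, mul_div_assoc', mul_add, mul_sub,
      ← Real.exp_add]
    ring_nf
  rw [← key]
  ring

lemma hasDerivAt_mallowsCDF {β : ℝ} (hβ : β ≠ 0) (x : ℝ) {y : ℝ}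
    (hy : y ∈ Set.Icc (0 : ℝ) 1) :
    HasDerivAt (fun x => mallowsCDF x y β) (mallowsU x y β) x := by
  have h1 : HasDerivAt (fun x => β * x / 2) (β / 2) x := by
    simpa using ((hasDerivAt_id x).const_mul β).div_const 2
  refine ((h1.sinh.const_mul (Real.exp (β / 4 - β * y / 2))).div
    (hasDerivAt_mallowsDenom_left x y β) (mallowsDenom_ne_zero hβ x hy)).congr_deriv ?_
  rw [mallowsU_eq_div hβ]
  congr 1
  have key : Real.exp (β / 4 - β * y / 2) * (Real.cosh (β * x / 2) * mallowsDenom x y β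
      - Real.sinh (β * x / 2) * (Real.exp (β / 4) * Real.sinh (β * (x - y) / 2)
        - Real.exp (-β / 4) * Real.sinh (β * (x + y - 1) / 2))) = Real.sinh (β / 2) := by
    simp only [mallowsDenom, Real.cosh_eq, Real.sinh_eq]
    ring_nf
    simp only [← Real.exp_add, mul_assoc]
    ring_nf
  rw [← key]
  ring

lemma mallowsCDF_zero (y β : ℝ) : mallowsCDF 0 y β = 0 := by
  simp [mallowsCDF]

lemma mallowsCDF_one {β : ℝ} (hβ : β ≠ 0) {y : ℝ} (hy : y ∈ Set.Icc (0 : ℝ) 1) :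
    mallowsCDF 1 y β = 1 := by
  rw [mallowsCDF, div_eq_one_iff_eq (mallowsDenom_ne_zero hβ 1 hy)]
  simp only [mallowsDenom, Real.cosh_eq, Real.sinh_eq, mul_div_assoc', mul_add, mul_sub,
    ← Real.exp_add]
  ring_nf

lemma continuous_mallowsDenom_left (y β : ℝ) : Continuous fun x => mallowsDenom x y β := by
  unfold mallowsDenom
  fun_prop

lemma continuous_mallowsDenom_right (x β : ℝ) : Continuous fun y => mallowsDenom x y β := by
  unfold mallowsDenom
  fun_prop

lemma integral_mallowsU {β : ℝ} (hβ : β ≠ 0) (s t : ℝ) {y : ℝ} (hy : y ∈ Set.Icc (0 : ℝ) 1) :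
    ∫ x in s..t, mallowsU x y β = mallowsCDF t y β - mallowsCDF s y β := by
  refine intervalIntegral.integral_eq_sub_of_hasDerivAt
    (fun x _ => hasDerivAt_mallowsCDF hβ x hy) (Continuous.intervalIntegrable ?_ _ _)
  simp only [mallowsU_eq_div hβ]
  exact continuous_const.div ((continuous_mallowsDenom_left y β).pow 2)
    fun x => pow_ne_zero 2 (mallowsDenom_ne_zero hβ x hy)

lemma mallowsU_ne_zero {β : ℝ} (hβ : β ≠ 0) (x : ℝ) {y : ℝ} (hy : y ∈ Set.Icc (0 : ℝ) 1) :
    mallowsU x y β ≠ 0 := by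
  rw [mallowsU_eq_div hβ]
  have : Real.sinh (β / 2) ≠ 0 := Real.sinh_ne_zero.2 (by simpa using hβ)
  have := mallowsDenom_ne_zero hβ x hy
  positivity

lemma hasDerivAt_log_mallowsU {β : ℝ} (hβ : β ≠ 0) (x : ℝ) {y : ℝ}
    (hy : y ∈ Set.Icc (0 : ℝ) 1) :
    HasDerivAt (fun y => Real.log (mallowsU x y β)) (-β * (1 - 2 * mallowsCDF x y β)) y := by
  have hD := mallowsDenom_ne_zero hβ x hy
  have hU := mallowsU_ne_zero hβ x hy
  have hs : Real.sinh (β / 2) ≠ 0 := Real.sinh_ne_zero.2 (by simpa using hβ)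
  simp only [mallowsU_eq_div hβ] at hU ⊢
  refine (((hasDerivAt_const y (β / 2 * Real.sinh (β / 2))).div
    ((hasDerivAt_mallowsDenom_right x y β).pow 2) (pow_ne_zero 2 hD)).log hU).congr_deriv ?_
  simp only [mallowsCDF, Pi.div_apply, Pi.pow_apply]
  field_simp
  ring

/-- **Lemma 3.6.** For any `a, c, d ∈ [0,1]`,
`−β ∫_c^d ( −∫₀^a u(x,y) dx + ∫_a^1 u(x,y) dx ) dy = ln( u(a,d) / u(a,c) )`,
where `u(x,y) = u(x,y,β)`. -/
theorem mallowsU_log_ratio (β : ℝ) (a c d : ℝ)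
    (haI : a ∈ Set.Icc (0 : ℝ) 1) (hcI : c ∈ Set.Icc (0 : ℝ) 1)
    (hdI : d ∈ Set.Icc (0 : ℝ) 1) :
    -β * (∫ y in c..d,
        (-(∫ x in (0:ℝ)..a, mallowsU x y β) + ∫ x in a..(1:ℝ), mallowsU x y β))
      = Real.log (mallowsU a d β / mallowsU a c β) := by
  rcases eq_or_ne β 0 with rfl | hβ
  · simp [mallowsU]
  have hsub : Set.uIcc c d ⊆ Set.Icc 0 1 := Set.uIcc_subset_Icc hcI hdI
  have hinner : Set.EqOn
      (fun y => -(∫ x in (0:ℝ)..a, mallowsU x y β) + ∫ x in a..(1:ℝ), mallowsU x y β)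
      (fun y => 1 - 2 * mallowsCDF a y β) (Set.uIcc c d) := fun y hy => by
    simp only [integral_mallowsU hβ _ _ (hsub hy), mallowsCDF_zero, mallowsCDF_one hβ (hsub hy)]
    ring
  rw [intervalIntegral.integral_congr hinner, ← intervalIntegral.integral_const_mul,
    Real.log_div (mallowsU_ne_zero hβ a hdI) (mallowsU_ne_zero hβ a hcI)]
  refine intervalIntegral.integral_eq_sub_of_hasDerivAt
    (fun y hy => hasDerivAt_log_mallowsU hβ a (hsub hy)) (ContinuousOn.intervalIntegrable ?_)
  have hcont : ContinuousOn (fun y => mallowsCDF a y β) (Set.uIcc c d) :=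
    ContinuousOn.div (by fun_prop) (continuous_mallowsDenom_right a β).continuousOn
      fun y hy => mallowsDenom_ne_zero hβ a (hsub hy)
  fun_prop
end
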